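/- Let n be a positive integer and let h₂(α) = 2α^{2n+1} + α^{2n} + α + 2. Then h₂ has no multiple complex root α with |α| ≥ 1; that is, there is no α ∈ ℂ with |α| ≥ 1 such that h₂(α) = 0 and h₂′(α) = 0. -/

import Mathlib

open Polynomial

/-- A common zero of `2 z ^ (m + 1) + z ^ m + z + 2` and its derivative (here multiplied by `z`)
is a root of a self-reciprocal quadratic. -/
lemma quadratic_eq_zero_of_double_root {m z w : ℂ}
    (h : w * (2 * z + 1) + z + 2 = 0) (h' : w * (2 * (m + 1) * z + m) + z = 0) :
    2 * m * z ^ 2 + (5 * m + 3) * z + 2 * m = 0 := by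
  linear_combination (2 * (m + 1) * z + m) * h - (2 * z + 1) * h'

/-- The roots of `2 m z ^ 2 + (5 m + 3) z + 2 m` are real for `m > 0`. -/
lemma im_eq_zero_of_quadratic {m : ℝ} (hm : 0 < m) {z : ℂ}
    (h : 2 * (m : ℂ) * z ^ 2 + (5 * m + 3) * z + 2 * m = 0) : z.im = 0 := by
  obtain ⟨x, y⟩ := z
  have hre := congrArg Complex.re h
  have him := congrArg Complex.im h
  simp [pow_two] at hre him
  by_contra hy
  have hx : 4 * m * x + (5 * m + 3) = 0 := by
    apply mul_right_cancel₀ hy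
    linear_combination him
  have hxy : x ^ 2 + y ^ 2 = 1 := by
    apply mul_left_cancel₀ hm.ne'
    linear_combination (x * hx - hre) / 2
  nlinarith [sq_nonneg y, sq_nonneg (x + 1)]

/-- Real case: a real root of the quadratic with `1 ≤ |x|` is not a zero of
`x ^ (2 n) (2 x + 1) + x + 2`. -/
lemma real_root_ne_zero {n : ℕ} {m x : ℝ} (hm : 0 < m) (hx : 1 ≤ |x|)
    (hq : 2 * m * x ^ 2 + (5 * m + 3) * x + 2 * m = 0) :
    x ^ (2 * n) * (2 * x + 1) + x + 2 ≠ 0 := by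
  intro h
  have hneg : x < 0 := by
    by_contra! hx0
    nlinarith [mul_nonneg hm.le hx0, mul_nonneg hm.le (sq_nonneg x)]
  rw [abs_of_neg hneg] at hx
  have hw : 1 ≤ x ^ (2 * n) := by
    rw [pow_mul]
    exact one_le_pow₀ (by nlinarith)
  have hx1 : x = -1 := by
    apply le_antisymm <;> nlinarith
  subst hx1
  linarith

/-- For a positive integer `n`, the polynomial
`h₂(α) = 2·α^(2n+1) + α^(2n) + α + 2` has no multiple complex root `α` with
`|α| ≥ 1`: there is no `α : ℂ` with `1 ≤ ‖α‖` such that both `h₂` and its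
derivative vanish at `α`. -/
theorem h2_no_multiple_root_outside_unit_disk
    (n : ℕ) (hn : 1 ≤ n)
    (h₂ : Polynomial ℂ)
    (hh₂ : h₂ = Polynomial.C 2 * Polynomial.X ^ (2 * n + 1)
        + Polynomial.X ^ (2 * n) + Polynomial.X + Polynomial.C 2) :
    ¬ ∃ α : ℂ, 1 ≤ ‖α‖ ∧ h₂.eval α = 0 ∧ (Polynomial.derivative h₂).eval α = 0 := by
  rintro ⟨z, hz, h, h'⟩
  have hm : (0 : ℝ) < 2 * n := by exact_mod_cast (by omega : 0 < 2 * n)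
  have hroot : z ^ (2 * n) * (2 * z + 1) + z + 2 = 0 := by
    simp [hh₂] at h
    linear_combination h
  have hderiv : z ^ (2 * n) * (2 * (2 * n + 1) * z + 2 * n) + z = 0 := by
    have hpow : z ^ (2 * n) = z ^ (2 * n - 1) * z := by
      rw [← pow_succ]; congr 1; omega
    simp [hh₂, derivative_X_pow] at h'
    rw [hpow] at h' ⊢
    linear_combination z * h'
  have hq := quadratic_eq_zero_of_double_root hroot hderiv
  have him : z.im = 0 := im_eq_zero_of_quadratic hm (by push_cast; exact hq)
  obtain ⟨x, rfl⟩ : ∃ x : ℝ, (x : ℂ) = z := ⟨z.re, Complex.ext rfl (by simp [him])⟩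
  rw [Complex.norm_real, Real.norm_eq_abs] at hz
  exact real_root_ne_zero (n := n) hm hz (by exact_mod_cast hq) (by exact_mod_cast hroot)
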